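/- For any congestion policy C with C(k) = 0, all symmetric equilibria are equivalent: if A and A′ are both symmetric equilibria for k players, then their probability matrices are equal. -/

import Mathlib

open Finset

/-- `A` is a doubly-substochastic `M × T` matrix: boxes `1..M`, rounds `1..T`,
nonnegative entries, every row and every column sums to at most 1. -/
def Substochastic (M T : ℕ) (A : ℕ → ℕ → ℝ) : Prop :=
  (∀ x t, 0 ≤ A x t) ∧
  (∀ x ∈ Icc 1 M, ∑ t ∈ Icc 1 T, A x t ≤ 1) ∧
  (∀ t ∈ Icc 1 T, ∑ x ∈ Icc 1 M, A x t ≤ 1)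

/-- `N̄_A(x,t)`: the probability that `A` does not visit box `x` by (and including) round `t`. -/
def Nbar (A : ℕ → ℕ → ℝ) (x t : ℕ) : ℝ := 1 - ∑ s ∈ Icc 1 t, A x s

/-- `f` is a positive, nonincreasing probability distribution on boxes `1..M`. -/
def BoxDist (M : ℕ) (f : ℕ → ℝ) : Prop :=
  (∀ x ∈ Icc 1 M, 0 < f x) ∧
  (∀ x, 1 ≤ x → x + 1 ≤ M → f (x + 1) ≤ f x) ∧
  (∑ x ∈ Icc 1 M, f x = 1)

/-- `C` is a congestion policy for `k` players: nonnegative, nonincreasing on `1..k`,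
`C 1 = 1`, and `C ℓ < 1` for some `ℓ ≤ k`. -/
def Policy (k : ℕ) (C : ℕ → ℝ) : Prop :=
  (∀ ℓ, 1 ≤ ℓ → ℓ ≤ k → 0 ≤ C ℓ) ∧ (C 1 = 1) ∧
  (∀ ℓ ℓ', 1 ≤ ℓ → ℓ ≤ ℓ' → ℓ' ≤ k → C ℓ' ≤ C ℓ) ∧
  (∃ ℓ, 1 ≤ ℓ ∧ ℓ ≤ k ∧ C ℓ < 1)

/-- The value of box `x` at round `t` against `k-1` copies of `A`. -/
def val (k : ℕ) (C f : ℕ → ℝ) (A : ℕ → ℕ → ℝ) (x t : ℕ) : ℝ :=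
  f x * ∑ ℓ ∈ range k,
    C (ℓ + 1) * ((k - 1).choose ℓ : ℝ) * A x t ^ ℓ * Nbar A x t ^ (k - 1 - ℓ)

/-- The utility of `B` against `k-1` copies of `A`. -/
def util (M T k : ℕ) (C f : ℕ → ℝ) (A B : ℕ → ℕ → ℝ) : ℝ :=
  ∑ t ∈ Icc 1 T, ∑ x ∈ Icc 1 M, B x t * val k C f A x t

/-- `A` is non-redundant: each column `t ≤ min T M` sums to exactly 1. -/
def NonRedundant (M T : ℕ) (A : ℕ → ℕ → ℝ) : Prop :=
  ∀ t, 1 ≤ t → t ≤ min T M → ∑ x ∈ Icc 1 M, A x t = 1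

/-- `A` is self-greedy: for each round `t ≤ T` it is greedy at round `t` with respect to
`k-1` copies of itself. -/
def SGreedy (M T k : ℕ) (C f : ℕ → ℝ) (A : ℕ → ℕ → ℝ) : Prop :=
  ∀ t, 1 ≤ t → t ≤ T → ∀ B, Substochastic M T B →
    (∀ x s, s < t → B x s = A x s) →
    ∑ x ∈ Icc 1 M, B x t * val k C f A x t ≤ ∑ x ∈ Icc 1 M, A x t * val k C f A x t

/-- `A` is a symmetric equilibrium for `k` players: no substochastic deviation `B` gains
against `k-1` copies of `A`. -/
def SymEquilibrium (M T k : ℕ) (C f : ℕ → ℝ) (A : ℕ → ℕ → ℝ) : Prop :=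
  ∀ B, Substochastic M T B → util M T k C f A B ≤ util M T k C f A A

/-- The expectation-like polynomial `∑ ℓ, C (j + ℓ) * (m choose ℓ) * a ^ ℓ * n ^ (m - ℓ)`. -/
def congestionPoly (C : ℕ → ℝ) (m j : ℕ) (a n : ℝ) : ℝ :=
  ∑ ℓ ∈ range (m + 1), C (j + ℓ) * (m.choose ℓ : ℝ) * a ^ ℓ * n ^ (m - ℓ)

lemma congestionPoly_zero (C : ℕ → ℝ) (j : ℕ) (a n : ℝ) : congestionPoly C 0 j a n = C j := by
  simp [congestionPoly]

/-- Conditioning on one of the `m + 1` opponents. -/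
lemma congestionPoly_succ (C : ℕ → ℝ) (m j : ℕ) (a n : ℝ) :
    congestionPoly C (m + 1) j a n =
      n * congestionPoly C m j a n + a * congestionPoly C m (j + 1) a n := by
  have h1 : n * congestionPoly C m j a n =
      ∑ ℓ ∈ range (m + 1), C (j + (ℓ + 1)) * (m.choose (ℓ + 1) : ℝ) * a ^ (ℓ + 1) * n ^ (m - ℓ)
        + C j * n ^ (m + 1) := by
    rw [sum_range_succ]
    simp only [Nat.choose_succ_self, Nat.cast_zero, mul_zero, zero_mul, add_zero]
    rw [congestionPoly, sum_range_succ', mul_add, mul_sum]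
    congr 1
    · refine sum_congr rfl fun ℓ hℓ => ?_
      obtain ⟨d, rfl⟩ := Nat.exists_eq_add_of_lt (mem_range.1 hℓ)
      rw [show ℓ + d + 1 - (ℓ + 1) = d by omega, show ℓ + d + 1 - ℓ = d + 1 by omega]
      ring
    · simp
      ring
  rw [h1, congestionPoly, congestionPoly, sum_range_succ', mul_sum, add_right_comm,
    ← sum_add_distrib]
  congr 1
  · refine sum_congr rfl fun ℓ _ => ?_
    rw [Nat.choose_succ_succ, show m + 1 - (ℓ + 1) = m - ℓ by omega,
      show j + 1 + ℓ = j + (ℓ + 1) by ring]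
    push_cast
    ring
  · simp

/-- A lower bound on the cost of one additional competitor. -/
lemma last_term_le_congestionPoly_sub {C : ℕ → ℝ} {m j : ℕ} {a n : ℝ} (ha : 0 ≤ a) (hn : 0 ≤ n)
    (h : ∀ i, j ≤ i → i < j + (m + 1) → C (i + 1) ≤ C i) :
    (C (j + m) - C (j + m + 1)) * a ^ m ≤
      congestionPoly C m j a n - congestionPoly C m (j + 1) a n := by
  rw [congestionPoly, congestionPoly, ← sum_sub_distrib, sum_range_succ]
  have h0 : 0 ≤ ∑ ℓ ∈ range m, (C (j + ℓ) * (m.choose ℓ : ℝ) * a ^ ℓ * n ^ (m - ℓ)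
      - C (j + 1 + ℓ) * (m.choose ℓ : ℝ) * a ^ ℓ * n ^ (m - ℓ)) := by
    refine sum_nonneg fun ℓ hℓ => ?_
    have h2 := h (j + ℓ) (by omega) (by have := mem_range.1 hℓ; omega)
    have h3 : 0 ≤ (C (j + ℓ) - C (j + ℓ + 1)) * ((m.choose ℓ : ℝ) * a ^ ℓ * n ^ (m - ℓ)) :=
      mul_nonneg (sub_nonneg.2 h2) (by positivity)
    rw [show j + 1 + ℓ = j + ℓ + 1 by ring]
    linarith
  rw [show j + 1 + m = j + m + 1 by ring]
  simp only [Nat.choose_self, Nat.cast_one, mul_one, Nat.sub_self, pow_zero]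
  linarith

lemma congestionPoly_anti {C : ℕ → ℝ} {p a b : ℝ} (ha : 0 ≤ a) (hab : a ≤ b) (hb : b ≤ p)
    (m j : ℕ) (h : ∀ i, j ≤ i → i < j + m → C (i + 1) ≤ C i) :
    congestionPoly C m j b (p - b) ≤ congestionPoly C m j a (p - a) := by
  induction m generalizing j with
  | zero => simp [congestionPoly_zero]
  | succ m ih =>
    rw [congestionPoly_succ, congestionPoly_succ]
    have h1 := ih j fun i h1 h2 => h i h1 (by omega)
    have h2 := ih (j + 1) fun i h1 h2 => h i (by omega) (by omega)
    have h3 := last_term_le_congestionPoly_sub (ha.trans hab) (sub_nonneg.2 hb) h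
    have h4 : 0 ≤ (C (j + m) - C (j + m + 1)) * b ^ m :=
      mul_nonneg (sub_nonneg.2 (h (j + m) (by omega) (by omega))) (pow_nonneg (ha.trans hab) _)
    nlinarith [mul_nonneg (sub_nonneg.2 (hab.trans hb)) (sub_nonneg.2 h1),
      mul_nonneg ha (sub_nonneg.2 h2), mul_nonneg (sub_nonneg.2 hab) (h4.trans h3)]

/-- Visiting a box more often in a round strictly lowers its value, as long as congestion has
some effect. -/
lemma congestionPoly_strictAnti {C : ℕ → ℝ} {p a b : ℝ} (ha : 0 ≤ a) (hab : a < b) (hb : b ≤ p)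
    (m j : ℕ) (h : ∀ i, j ≤ i → i < j + m → C (i + 1) ≤ C i) (hlt : C (j + m) < C j) :
    congestionPoly C m j b (p - b) < congestionPoly C m j a (p - a) := by
  induction m generalizing j with
  | zero => simp at hlt
  | succ m ih =>
    rw [congestionPoly_succ, congestionPoly_succ]
    have hj : ∀ i, j ≤ i → i < j + m → C (i + 1) ≤ C i := fun i h1 h2 => h i h1 (by omega)
    have h1 := congestionPoly_anti ha hab.le hb m j hj
    have h2 := congestionPoly_anti ha hab.le hb m (j + 1)
      fun i h1 h2 => h i (by omega) (by omega)
    have h3 := last_term_le_congestionPoly_sub (ha.trans hab.le) (sub_nonneg.2 hb) h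
    have hb0 : 0 < b ^ m := pow_pos (ha.trans_lt hab) _
    have h5 := mul_nonneg ha (sub_nonneg.2 h2)
    rcases (h (j + m) (by omega) (by omega)).lt_or_eq with hl | he
    · have h4 : 0 < (C (j + m) - C (j + m + 1)) * b ^ m := mul_pos (sub_pos.2 hl) hb0
      nlinarith [mul_nonneg (sub_nonneg.2 (hab.le.trans hb)) (sub_nonneg.2 h1),
        mul_pos (sub_pos.2 hab) (h4.trans_le h3)]
    · have h4 : 0 ≤ (C (j + m) - C (j + m + 1)) * b ^ m :=
        mul_nonneg (sub_nonneg.2 he.le) hb0.le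
      have h6 := ih j hj (by rw [← he]; exact hlt)
      nlinarith [mul_pos (sub_pos.2 (hab.trans_le hb)) (sub_pos.2 h6),
        mul_nonneg (sub_nonneg.2 hab.le) (h4.trans h3)]

lemma val_eq_congestionPoly {k : ℕ} (hk : 1 ≤ k) (C f : ℕ → ℝ) (A : ℕ → ℕ → ℝ) (x t : ℕ) :
    val k C f A x t = f x * congestionPoly C (k - 1) 1 (A x t) (Nbar A x t) := by
  rw [_root_.val, congestionPoly, Nat.sub_add_cancel hk]
  simp only [add_comm 1]

lemma Nbar_succ (A : ℕ → ℕ → ℝ) (x t : ℕ) : Nbar A x (t + 1) = Nbar A x t - A x (t + 1) := by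
  rw [Nbar, Nbar, sum_Icc_succ_top (by omega)]
  ring

lemma Nbar_nonneg {M T : ℕ} {A : ℕ → ℕ → ℝ} (hA : Substochastic M T A) {x t : ℕ}
    (hx : x ∈ Icc 1 M) (ht : t ≤ T) : 0 ≤ Nbar A x t :=
  sub_nonneg.2 <| (sum_le_sum_of_subset_of_nonneg (Icc_subset_Icc_right ht)
    fun s _ _ => hA.1 x s).trans (hA.2.1 x hx)

lemma val_nonneg {M T k : ℕ} {C f : ℕ → ℝ} {A : ℕ → ℕ → ℝ} (hf : BoxDist M f)
    (hC : Policy k C) (hA : Substochastic M T A) {x t : ℕ} (hx : x ∈ Icc 1 M) (ht : t ≤ T) :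
    0 ≤ val k C f A x t := by
  refine mul_nonneg (hf.1 x hx).le (sum_nonneg fun ℓ hℓ => ?_)
  have h1 := hC.1 (ℓ + 1) (by omega) (mem_range.1 hℓ)
  have h2 := hA.1 x t
  have h3 := Nbar_nonneg hA hx ht
  positivity

/-- If full congestion is worth nothing, a box certainly visited by the opponents is worthless. -/
lemma val_eq_zero_of_Nbar_eq_zero {k : ℕ} {C : ℕ → ℝ} (hCk : C k = 0)
    (f : ℕ → ℝ) {A : ℕ → ℕ → ℝ} {x t : ℕ} (h : Nbar A x t = 0) : val k C f A x t = 0 := by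
  rw [_root_.val, h]
  refine mul_eq_zero_of_right _ (sum_eq_zero fun ℓ hℓ => ?_)
  have hℓk := mem_range.1 hℓ
  by_cases he : ℓ + 1 = k
  · rw [he, hCk]
    ring
  · rw [zero_pow (by omega), mul_zero]

/-- Dropping the worthless visits of `A`. -/
noncomputable def dropWorthless (k : ℕ) (C f : ℕ → ℝ) (A : ℕ → ℕ → ℝ) (x t : ℕ) : ℝ :=
  if val k C f A x t = 0 then 0 else A x t

lemma dropWorthless_mul_val (k : ℕ) (C f : ℕ → ℝ) (A : ℕ → ℕ → ℝ) (x t : ℕ) :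
    dropWorthless k C f A x t * val k C f A x t = A x t * val k C f A x t := by
  unfold dropWorthless
  split_ifs with h <;> simp [h]

lemma dropWorthless_nonneg {M T : ℕ} {A : ℕ → ℕ → ℝ} (hA : Substochastic M T A)
    (k : ℕ) (C f : ℕ → ℝ) (x t : ℕ) : 0 ≤ dropWorthless k C f A x t := by
  unfold dropWorthless
  split_ifs
  exacts [le_rfl, hA.1 x t]

lemma dropWorthless_le {M T : ℕ} {A : ℕ → ℕ → ℝ} (hA : Substochastic M T A)
    (k : ℕ) (C f : ℕ → ℝ) (x t : ℕ) : dropWorthless k C f A x t ≤ A x t := by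
  unfold dropWorthless
  split_ifs
  exacts [hA.1 x t, le_rfl]

lemma sum_dropWorthless_lt_one {M T k : ℕ} {C f : ℕ → ℝ} {A : ℕ → ℕ → ℝ} (hCk : C k = 0)
    (hA : Substochastic M T A) {x t : ℕ} (hx : x ∈ Icc 1 M) (ht : t ≤ T) :
    ∑ s ∈ Icc 1 t, dropWorthless k C f A x s < 1 := by
  induction t with
  | zero => simp
  | succ t ih =>
    by_cases h : val k C f A x (t + 1) = 0
    · rw [sum_Icc_succ_top (by omega)]
      simpa [dropWorthless, h] using ih (by omega)
    · have h1 : 0 < Nbar A x (t + 1) := (Nbar_nonneg hA hx ht).lt_of_ne'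
        fun h0 => h (val_eq_zero_of_Nbar_eq_zero hCk f h0)
      exact (sum_le_sum fun s _ => dropWorthless_le hA k C f x s).trans_lt (sub_pos.1 h1)

/-- In equilibrium no box is worth more in a given round than what a player gains in that round. -/
lemma val_le_round_utility {M T k : ℕ} {C f : ℕ → ℝ} {A : ℕ → ℕ → ℝ} (hCk : C k = 0)
    (hA : Substochastic M T A) (hEq : SymEquilibrium M T k C f A) {y t : ℕ}
    (hy : y ∈ Icc 1 M) (ht : t ∈ Icc 1 T) :
    val k C f A y t ≤ ∑ x ∈ Icc 1 M, A x t * val k C f A x t := by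
  set D := dropWorthless k C f A with hD
  have hD0 : ∀ x s, 0 ≤ D x s := dropWorthless_nonneg hA k C f
  have hDA : ∀ x s, D x s ≤ A x s := dropWorthless_le hA k C f
  set ε := 1 - ∑ s ∈ Icc 1 T, D y s with hε
  have hε0 : 0 < ε := sub_pos.2 (sum_dropWorthless_lt_one hCk hA hy le_rfl)
  have hε1 : ε ≤ 1 := sub_le_self _ (sum_nonneg fun s _ => hD0 y s)
  set B : ℕ → ℕ → ℝ := fun x s =>
    D x s + if s = t then ε * ((if x = y then 1 else 0) - D x t) else 0 with hB
  have hBsub : Substochastic M T B := by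
    refine ⟨fun x s => ?_, fun x hx => ?_, fun s hs => ?_⟩
    · have h1 := hD0 x s
      simp only [hB]
      split_ifs with h2 h3
      · subst h2
        nlinarith
      · subst h2
        nlinarith
      · simpa using h1
    · simp only [hB]
      rw [sum_add_distrib, sum_ite_eq' (Icc 1 T) t, if_pos ht]
      have h1 := hD0 x t
      split_ifs with h2
      · subst h2
        nlinarith
      · have h3 := sum_dropWorthless_lt_one (f := f) hCk hA hx le_rfl
        rw [← hD] at h3
        nlinarith
    · simp only [hB]
      have h1 : ∑ x ∈ Icc 1 M, D x s ≤ 1 :=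
        (sum_le_sum fun x _ => hDA x s).trans (hA.2.2 s hs)
      by_cases h2 : s = t
      · subst h2
        simp only [if_true]
        rw [sum_add_distrib, ← mul_sum, sum_sub_distrib, sum_ite_eq' (Icc 1 M) y, if_pos hy]
        nlinarith
      · simpa [h2] using h1
  have hu : util M T k C f A B = util M T k C f A A +
      ε * (val k C f A y t - ∑ x ∈ Icc 1 M, A x t * val k C f A x t) := by
    have h1 : ∀ s ∈ Icc 1 T, ∑ x ∈ Icc 1 M, B x s * val k C f A x s =
        ∑ x ∈ Icc 1 M, A x s * val k C f A x s + if s = t then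
          ε * (val k C f A y t - ∑ x ∈ Icc 1 M, A x t * val k C f A x t) else 0 := by
      intro s _
      by_cases h2 : s = t
      · subst h2
        have h3 : ∀ x ∈ Icc 1 M, B x s * val k C f A x s = A x s * val k C f A x s +
            ε * ((if x = y then val k C f A x s else 0) - A x s * val k C f A x s) := by
          intro x _
          have h4 : D x s * val k C f A x s = A x s * val k C f A x s :=
            dropWorthless_mul_val k C f A x s
          simp only [hB, if_true]
          split_ifs <;> linear_combination (1 - ε) * h4
        rw [sum_congr rfl h3, sum_add_distrib, ← mul_sum, sum_sub_distrib,
          sum_ite_eq' (Icc 1 M) y, if_pos hy, if_pos rfl]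
      · simp only [hB, h2, if_false, add_zero]
        exact sum_congr rfl fun x _ => dropWorthless_mul_val k C f A x s
    rw [util, sum_congr rfl h1, sum_add_distrib, sum_ite_eq' (Icc 1 T) t, if_pos ht, util]
  have h := hEq B hBsub
  rw [hu] at h
  nlinarith

section IdealFreeDistribution

variable {ι : Type*} {S : Finset ι} {a v : ι → ℝ}

/-- If no value exceeds the average payoff, every alternative in use attains it. -/
lemma eq_average_of_pos (ha : ∀ x ∈ S, 0 ≤ a x)
    (hs : ∑ x ∈ S, a x ≤ 1) (hv0 : ∀ x ∈ S, 0 ≤ v x) (hv : ∀ x ∈ S, v x ≤ ∑ y ∈ S, a y * v y) :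
    ∀ x ∈ S, 0 < a x → v x = ∑ y ∈ S, a y * v y := by
  intro x hx hpos
  set W := ∑ y ∈ S, a y * v y with hW
  have hW0 : 0 ≤ W := sum_nonneg fun y hy => mul_nonneg (ha y hy) (hv0 y hy)
  have h1 : ∑ y ∈ S, a y * (W - v y) = (∑ y ∈ S, a y) * W - W := by
    simp only [mul_sub, sum_sub_distrib, ← sum_mul, ← hW]
  have h2 : a x * (W - v x) ≤ ∑ y ∈ S, a y * (W - v y) :=
    single_le_sum (f := fun y => a y * (W - v y))
      (fun y hy => mul_nonneg (ha y hy) (sub_nonneg.2 (hv y hy))) hx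
  have h3 := hv x hx
  by_contra hne
  have h4 := mul_pos hpos (sub_pos.2 (lt_of_le_of_ne h3 hne))
  nlinarith

lemma one_le_sum_of_average_pos (ha : ∀ x ∈ S, 0 ≤ a x)
    (hv : ∀ x ∈ S, v x ≤ ∑ y ∈ S, a y * v y) (hW : 0 < ∑ y ∈ S, a y * v y) :
    1 ≤ ∑ x ∈ S, a x := by
  have h1 : ∑ y ∈ S, a y * v y ≤ (∑ x ∈ S, a x) * ∑ y ∈ S, a y * v y := by
    conv_rhs => rw [sum_mul]
    exact sum_le_sum fun y hy => mul_le_mul_of_nonneg_left (hv y hy) (ha y hy)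
  nlinarith

/-- Uniqueness of the ideal free distribution when values strictly decrease with use. -/
lemma idealFree_unique {a' v' : ι → ℝ}
    (ha : ∀ x ∈ S, 0 ≤ a x) (ha' : ∀ x ∈ S, 0 ≤ a' x)
    (hs : ∑ x ∈ S, a x ≤ 1) (hs' : ∑ x ∈ S, a' x ≤ 1)
    (hv0 : ∀ x ∈ S, 0 ≤ v x) (hv0' : ∀ x ∈ S, 0 ≤ v' x)
    (hv : ∀ x ∈ S, v x ≤ ∑ y ∈ S, a y * v y)
    (hv' : ∀ x ∈ S, v' x ≤ ∑ y ∈ S, a' y * v' y)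
    (hlt : ∀ x ∈ S, a x < a' x → v' x < v x) (hlt' : ∀ x ∈ S, a' x < a x → v x < v' x) :
    ∀ x ∈ S, a x = a' x := by
  wlog hW : ∑ y ∈ S, a' y * v' y ≤ ∑ y ∈ S, a y * v y generalizing a a' v v'
  · exact fun x hx => (this ha' ha hs' hs hv0' hv0 hv' hv hlt' hlt (le_of_not_ge hW) x hx).symm
  have hle : ∀ x ∈ S, a x ≤ a' x := by
    intro x hx
    by_contra! h
    have h1 := eq_average_of_pos ha hs hv0 hv x hx ((ha' x hx).trans_lt h)
    linarith [hv' x hx, hlt' x hx h]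
  rcases (sum_nonneg fun y hy => mul_nonneg (ha y hy) (hv0 y hy) :
    0 ≤ ∑ y ∈ S, a y * v y).lt_or_eq with hpos | hzero
  · have h1 := one_le_sum_of_average_pos ha hv hpos
    exact (sum_eq_sum_iff_of_le hle).1 (le_antisymm (sum_le_sum hle) (hs'.trans h1))
  · intro x hx
    refine (hle x hx).eq_of_not_lt fun h => ?_
    have h1 := hlt x hx h
    linarith [hv x hx, hv0' x hx]

end IdealFreeDistribution

/-- Among strategies with the same history, a more visited box has a smaller value. -/
lemma val_lt_val_of_lt {M T k : ℕ} {C f : ℕ → ℝ} {A A' : ℕ → ℕ → ℝ} (hk : 1 ≤ k)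
    (hf : BoxDist M f) (hC : Policy k C) (hCk : C k = 0)
    (hA : Substochastic M T A) (hA' : Substochastic M T A') {x t : ℕ} (hx : x ∈ Icc 1 M)
    (ht : t + 1 ≤ T) (hN : Nbar A x t = Nbar A' x t) (hlt : A x (t + 1) < A' x (t + 1)) :
    val k C f A' x (t + 1) < val k C f A x (t + 1) := by
  rw [val_eq_congestionPoly hk, val_eq_congestionPoly hk, Nbar_succ, Nbar_succ, hN]
  have h1 := Nbar_nonneg hA' hx ht
  rw [Nbar_succ, sub_nonneg] at h1
  refine mul_lt_mul_of_pos_left (congestionPoly_strictAnti (hA.1 _ _) hlt h1 _ _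
    (fun i h2 h3 => hC.2.2.1 i (i + 1) h2 (by omega) (by omega)) ?_) (hf.1 x hx)
  rw [Nat.add_sub_cancel' hk, hCk, hC.2.1]
  exact one_pos

/-- if `C k = 0`, all symmetric equilibria have equal probability matrices. -/
theorem symmetric_equilibria_unique_of_Ck_eq_zero
    (M T k : ℕ) (hM : 1 ≤ M) (hT : 1 ≤ T) (hk : 2 ≤ k)
    (f C : ℕ → ℝ) (hf : BoxDist M f) (hC : Policy k C) (hCk : C k = 0)
    (A A' : ℕ → ℕ → ℝ)
    (hA : Substochastic M T A) (hEq : SymEquilibrium M T k C f A)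
    (hA' : Substochastic M T A') (hEq' : SymEquilibrium M T k C f A') :
    ∀ x ∈ Icc 1 M, ∀ t ∈ Icc 1 T, A x t = A' x t := by
  have hN : ∀ t ≤ T, ∀ x ∈ Icc 1 M, Nbar A x t = Nbar A' x t ∧ (1 ≤ t → A x t = A' x t) := by
    intro t
    induction t with
    | zero => simp [Nbar]
    | succ t ih =>
      intro ht
      have hmem : t + 1 ∈ Icc 1 T := mem_Icc.2 ⟨by omega, ht⟩
      have hprev : ∀ x ∈ Icc 1 M, Nbar A x t = Nbar A' x t :=
        fun x hx => (ih (by omega) x hx).1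
      have h := idealFree_unique (S := Icc 1 M)
        (fun x _ => hA.1 x (t + 1)) (fun x _ => hA'.1 x (t + 1))
        (hA.2.2 _ hmem) (hA'.2.2 _ hmem)
        (fun x hx => val_nonneg hf hC hA hx ht) (fun x hx => val_nonneg hf hC hA' hx ht)
        (fun x hx => val_le_round_utility hCk hA hEq hx hmem)
        (fun x hx => val_le_round_utility hCk hA' hEq' hx hmem)
        (fun x hx => val_lt_val_of_lt (by omega) hf hC hCk hA hA' hx ht (hprev x hx))
        (fun x hx => val_lt_val_of_lt (by omega) hf hC hCk hA' hA hx ht (hprev x hx).symm)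
      intro x hx
      refine ⟨?_, fun _ => h x hx⟩
      rw [Nbar_succ, Nbar_succ, hprev x hx, h x hx]
  intro x hx t ht
  exact (hN t (mem_Icc.1 ht).2 x hx).2 (mem_Icc.1 ht).1
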